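/- Let q > 1, 0 < α ≤ 1, n a positive natural number, λ ∈ ℝⁿ, and let B be the n × n real matrix (1/q)·I. Then for every real t ≥ 0 the vector series ∑_{k=0}^∞ [∏_{j=1}^{k} (-I + q^{-(k-j)α} B)] · λ · t^{kα}/Γ(kα+1) is convergent in ℝⁿ (the family of vector terms is summable). -/

import Mathlib

open MeasureTheory Set in
/-- A lower bound for the Gamma function, obtained by restricting Euler's integral to `(M, ∞)`. -/
theorem Real.rpow_mul_exp_neg_le_Gamma_add_one {x M : ℝ} (hx : 0 ≤ x) (hM : 0 ≤ M) :
    M ^ x * Real.exp (-M) ≤ Real.Gamma (x + 1) := by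
  have hint : IntegrableOn (fun u : ℝ => Real.exp (-u) * u ^ x) (Ioi 0) := by
    simpa using Real.GammaIntegral_convergent (s := x + 1) (by linarith)
  have hsub : Ioi M ⊆ Ioi 0 := Ioi_subset_Ioi hM
  rw [Real.Gamma_eq_integral (by linarith), add_sub_cancel_right]
  calc M ^ x * Real.exp (-M) = ∫ u in Ioi M, M ^ x * Real.exp (-u) := by
        rw [integral_const_mul, integral_exp_neg_Ioi]
    _ ≤ ∫ u in Ioi M, Real.exp (-u) * u ^ x := by
        refine setIntegral_mono_on ((integrableOn_exp_neg_Ioi M).const_mul _)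
          (hint.mono_set hsub) measurableSet_Ioi fun u hu => ?_
        rw [mul_comm]
        gcongr
        exact le_of_lt hu
    _ ≤ ∫ u in Ioi 0, Real.exp (-u) * u ^ x := by
        refine setIntegral_mono_set hint ?_ hsub.eventuallyLE
        filter_upwards [ae_restrict_mem measurableSet_Ioi] with u hu
        have : 0 < u := hu
        simp only [Pi.zero_apply]
        positivity

/-- The Mittag-Leffler series converges at every nonnegative power `t ^ α`. -/
theorem Real.summable_rpow_div_Gamma {α t : ℝ} (hα : 0 < α) (ht : 0 ≤ t) :
    Summable fun k : ℕ => t ^ ((k : ℝ) * α) / Real.Gamma ((k : ℝ) * α + 1) := by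
  have hr : (t / (t + 1)) ^ α < 1 :=
    Real.rpow_lt_one (by positivity) ((div_lt_one (by positivity)).2 (by linarith)) hα
  refine Summable.of_nonneg_of_le (fun k => ?_) (fun k => ?_)
    ((summable_geometric_of_lt_one (by positivity) hr).mul_left (Real.exp (t + 1)))
  · have := Real.Gamma_pos_of_pos (s := (k : ℝ) * α + 1) (by positivity)
    positivity
  · have hΓ := Real.rpow_mul_exp_neg_le_Gamma_add_one (x := (k : ℝ) * α) (M := t + 1)
      (by positivity) (by positivity)
    calc t ^ ((k : ℝ) * α) / Real.Gamma ((k : ℝ) * α + 1)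
        ≤ t ^ ((k : ℝ) * α) / ((t + 1) ^ ((k : ℝ) * α) * Real.exp (-(t + 1))) := by gcongr
      _ = Real.exp (t + 1) * ((t / (t + 1)) ^ α) ^ k := by
        rw [← Real.rpow_mul_natCast (by positivity), mul_comm α,
          Real.div_rpow ht (by positivity), Real.exp_neg]
        field_simp

theorem Matrix.exists_list_prod_eq_smul_one {ι : Type*} [Fintype ι] [DecidableEq ι]
    (l : List (Matrix ι ι ℝ)) (hl : ∀ A ∈ l, ∃ c : ℝ, |c| ≤ 1 ∧ A = c • (1 : Matrix ι ι ℝ)) :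
    ∃ c : ℝ, |c| ≤ 1 ∧ l.prod = c • (1 : Matrix ι ι ℝ) := by
  induction l with
  | nil => exact ⟨1, by simp, by simp⟩
  | cons A l ih =>
    obtain ⟨a, ha, rfl⟩ := hl A List.mem_cons_self
    obtain ⟨c, hc, h⟩ := ih fun A hA => hl A (List.mem_cons_of_mem _ hA)
    refine ⟨a * c, ?_, by rw [List.prod_cons, h, smul_mul_smul_comm, one_mul]⟩
    rw [abs_mul]
    exact mul_le_one₀ ha (abs_nonneg c) hc


/-- For `q > 1`, `0 < α ≤ 1`, `λ ∈ ℝⁿ` and `B = (1/q) • I`, the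
vector series `∑_k [∏_{j=1}^{k}(-I + q^{-(k-j)α} B)] λ · t^(kα)/Γ(kα+1)` is
summable in `ℝⁿ` for every real `t ≥ 0`. -/
theorem ambartsumian_system_series_summable (q α : ℝ) (hq : 1 < q) (hα0 : 0 < α)
    (hα1 : α ≤ 1) (n : ℕ) (hn : 0 < n) (lam : Fin n → ℝ)
    (B : Matrix (Fin n) (Fin n) ℝ) (hB : B = (1 / q) • (1 : Matrix (Fin n) (Fin n) ℝ))
    (t : ℝ) (ht : 0 ≤ t) :
    Summable (fun k : ℕ =>
      (t ^ ((k : ℝ) * α) / Real.Gamma ((k : ℝ) * α + 1)) •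
        Matrix.mulVec
          (((List.range k).map (fun j =>
            (-1 : Matrix (Fin n) (Fin n) ℝ) + q ^ (-((k - 1 - j : ℕ) : ℝ) * α) • B)).prod)
          lam) := by
  have hprod : ∀ k : ℕ, ∃ c : ℝ, |c| ≤ 1 ∧
      ((List.range k).map (fun j =>
        (-1 : Matrix (Fin n) (Fin n) ℝ) + q ^ (-((k - 1 - j : ℕ) : ℝ) * α) • B)).prod =
        c • (1 : Matrix (Fin n) (Fin n) ℝ) := by
    intro k
    refine Matrix.exists_list_prod_eq_smul_one _ fun A hA => ?_
    obtain ⟨j, -, rfl⟩ := List.mem_map.1 hA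
    have hpow : q ^ (-((k - 1 - j : ℕ) : ℝ) * α) ≤ 1 :=
      Real.rpow_le_one_of_one_le_of_nonpos hq.le
        (mul_nonpos_of_nonpos_of_nonneg (neg_nonpos.2 (Nat.cast_nonneg _)) hα0.le)
    have hpow0 : 0 < q ^ (-((k - 1 - j : ℕ) : ℝ) * α) := Real.rpow_pos_of_pos (by linarith) _
    have hq1 : 1 / q ≤ 1 := (div_le_one (by linarith)).2 hq.le
    have hq0 : 0 < 1 / q := by positivity
    refine ⟨-1 + q ^ (-((k - 1 - j : ℕ) : ℝ) * α) * (1 / q), ?_, ?_⟩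
    · have := mul_le_one₀ hpow hq0.le hq1
      have := mul_pos hpow0 hq0
      exact abs_le.2 ⟨by linarith, by linarith⟩
    · rw [hB, add_smul, smul_smul, neg_smul, one_smul]
  choose c hc hprod using hprod
  refine Summable.of_norm_bounded ((Real.summable_rpow_div_Gamma hα0 ht).mul_right ‖lam‖)
    fun k => ?_
  have hΓ := Real.Gamma_pos_of_pos (s := (k : ℝ) * α + 1) (by positivity)
  have hterm : 0 ≤ t ^ ((k : ℝ) * α) / Real.Gamma ((k : ℝ) * α + 1) := by positivity
  rw [hprod, Matrix.smul_mulVec, Matrix.one_mulVec, norm_smul, norm_smul,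
    Real.norm_of_nonneg hterm, Real.norm_eq_abs]
  exact mul_le_mul_of_nonneg_left (mul_le_of_le_one_left (norm_nonneg _) (hc k)) hterm
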